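/- For every integer n ≥ 3 and every vertex u ∈ V, the probability of the event E_{2,u} — that there exists a four-cycle rooted at u whose edge sequence pattern (writing s for a local edge and w for a long-range edge) is (s,s,w,s) or (s,w,s,s) — satisfies Pr(E_{2,u}) < (64/9) · ln(n/2)^{−1}. -/

import Mathlib

open scoped Classical
open Finset

/-- Vertex set of the `n × n` torus. -/
abbrev Vx (n : ℕ) := Fin n × Fin n

/-- Toroidal distance on the `n × n` torus. -/
def tdist (n : ℕ) (u v : Vx n) : ℕ :=
  min ((u.1 : ℤ) - (v.1 : ℤ)).natAbs (n - ((u.1 : ℤ) - (v.1 : ℤ)).natAbs) +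
  min ((u.2 : ℤ) - (v.2 : ℤ)).natAbs (n - ((u.2 : ℤ) - (v.2 : ℤ)).natAbs)

/-- The normalizing factor at vertex `u`. -/
noncomputable def Zfac (n : ℕ) (u : Vx n) : ℝ :=
  (∑ w ∈ univ.filter (fun w => w ≠ u), ((tdist n u w : ℝ) ^ 2)⁻¹)⁻¹

/-- The probability mass of the outcome `c : V → V` (the vector of long-range choices)
under the UTSW product measure: each vertex `u` independently chooses `c u = v ≠ u`
with probability `Z · d(u,v)⁻²`. -/
noncomputable def mass (n : ℕ) (c : Vx n → Vx n) : ℝ :=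
  ∏ u : Vx n, if c u = u then 0 else Zfac n u * ((tdist n u (c u) : ℝ) ^ 2)⁻¹

/-- Probability of an event under the UTSW product measure. -/
noncomputable def Pr (n : ℕ) (E : Set (Vx n → Vx n)) : ℝ :=
  ∑ c : Vx n → Vx n, if c ∈ E then mass n c else 0

/-- `{x, y}` is an edge of the UTSW random graph `G(c)`. -/
def isEdge (n : ℕ) (c : Vx n → Vx n) (x y : Vx n) : Prop :=
  x ≠ y ∧ (tdist n x y = 1 ∨ c x = y ∨ c y = x)

/-- `{x, y}` is an edge of `G(c)` of the given kind: local (`w = false`, distance one)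
or long-range (`w = true`, distance not one). -/
def edgeKind (n : ℕ) (c : Vx n → Vx n) (x y : Vx n) (w : Bool) : Prop :=
  isEdge n c x y ∧ (tdist n x y = 1 ↔ w = false)

/-- There is a four-cycle rooted at `u` in `G(c)` whose edge sequence has the local/long-range
pattern `(p₁, p₂, p₃, p₄)` (`false` = local edge, `true` = long-range edge). -/
def cyclePat (n : ℕ) (c : Vx n → Vx n) (u : Vx n) (p₁ p₂ p₃ p₄ : Bool) : Prop :=
  ∃ a b e : Vx n, a ≠ b ∧ a ≠ e ∧ b ≠ e ∧ a ≠ u ∧ b ≠ u ∧ e ≠ u ∧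
    edgeKind n c u a p₁ ∧ edgeKind n c a b p₂ ∧ edgeKind n c b e p₃ ∧ edgeKind n c e u p₄

/-- `ζ(3) = ∑_{i ≥ 1} i⁻³`. -/
noncomputable def zeta3 : ℝ := ∑' i : ℕ, ((i + 1 : ℝ) ^ 3)⁻¹

theorem tdist_comm (n : ℕ) (u v : Vx n) : tdist n u v = tdist n v u := by
  unfold tdist
  omega

theorem Zfac_nonneg (n : ℕ) (u : Vx n) : 0 ≤ Zfac n u := by
  unfold Zfac
  positivity

/-- The probability that `u` chooses `v`. -/
noncomputable def choiceProb (n : ℕ) (u v : Vx n) : ℝ :=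
  if v = u then 0 else Zfac n u * ((tdist n u v : ℝ) ^ 2)⁻¹

theorem choiceProb_nonneg (n : ℕ) (u v : Vx n) : 0 ≤ choiceProb n u v := by
  have := Zfac_nonneg n u
  unfold choiceProb
  split_ifs <;> positivity

theorem sum_choiceProb_le_one (n : ℕ) (u : Vx n) : ∑ v, choiceProb n u v ≤ 1 := by
  have h : ∑ v, choiceProb n u v =
      Zfac n u * ∑ w ∈ univ.filter (fun w => w ≠ u), ((tdist n u w : ℝ) ^ 2)⁻¹ := by
    rw [mul_sum, sum_filter]
    refine sum_congr rfl fun v _ => ?_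
    by_cases hv : v = u <;> simp [choiceProb, hv]
  rw [h, Zfac]
  exact inv_mul_le_one

theorem mass_nonneg (n : ℕ) (c : Vx n → Vx n) : 0 ≤ mass n c :=
  prod_nonneg fun u _ => choiceProb_nonneg n u (c u)

/-- The union bound. -/
theorem Pr_le_sum (n : ℕ) (E : Set (Vx n → Vx n)) (A : Finset (Vx n × Vx n))
    (h : ∀ c ∈ E, ∃ p ∈ A, c p.1 = p.2) : Pr n E ≤ ∑ p ∈ A, Pr n {c | c p.1 = p.2} := by
  unfold Pr
  rw [sum_comm]
  refine sum_le_sum fun c _ => ?_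
  have hite : ∀ F : Set (Vx n → Vx n), 0 ≤ if c ∈ F then mass n c else 0 := by
    intro F
    split_ifs
    · exact mass_nonneg n c
    · exact le_rfl
  by_cases hc : c ∈ E
  · obtain ⟨p, hp, hcp⟩ := h c hc
    refine le_trans ?_ (single_le_sum (fun p _ => hite {c | c p.1 = p.2}) hp)
    simp [hc, hcp]
  · rw [if_neg hc]
    exact sum_nonneg fun p _ => hite {c | c p.1 = p.2}

theorem Pr_choice_le (n : ℕ) (b e : Vx n) :
    Pr n {c | c b = e} ≤ Zfac n b * ((tdist n b e : ℝ) ^ 2)⁻¹ := by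
  let g : Vx n → Vx n → ℝ := fun u v => if u = b ∧ v ≠ e then 0 else choiceProb n u v
  have hg0 : ∀ u v, 0 ≤ g u v := fun u v => by
    dsimp only [g]
    split_ifs
    · exact le_rfl
    · exact choiceProb_nonneg n u v
  have hg : Pr n {c | c b = e} = ∏ u, ∑ v, g u v := by
    rw [Fintype.prod_sum]
    refine sum_congr rfl fun c _ => ?_
    by_cases hc : c b = e
    · rw [if_pos (by exact hc)]
      refine prod_congr rfl fun u _ => ?_
      have : ¬(u = b ∧ c u ≠ e) := by
        rintro ⟨rfl, h⟩
        exact h hc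
      simp only [g, if_neg this, choiceProb]
    · rw [if_neg (by exact hc)]
      exact (prod_eq_zero (mem_univ b) (by simp [g, hc])).symm
  have hb : ∑ v, g b v ≤ Zfac n b * ((tdist n b e : ℝ) ^ 2)⁻¹ := by
    have h1 : ∑ v, g b v = choiceProb n b e := by
      rw [sum_eq_single e]
      · simp [g]
      · intro v _ hv
        simp [g, hv]
      · simp
    have hZ := Zfac_nonneg n b
    rw [h1, choiceProb]
    split_ifs
    · positivity
    · exact le_rfl
  have hrest : ∏ u ∈ univ.erase b, ∑ v, g u v ≤ 1 := by
    refine prod_le_one (fun u _ => sum_nonneg fun v _ => hg0 u v) fun u hu => ?_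
    refine le_trans (le_of_eq (sum_congr rfl fun v _ => ?_)) (sum_choiceProb_le_one n u)
    simp [g, ne_of_mem_erase hu]
  rw [hg, ← mul_prod_erase univ _ (mem_univ b)]
  exact (mul_le_of_le_one_right (sum_nonneg fun v _ => hg0 b v) hrest).trans hb

/-- Translation by `p` on the cycle `Fin n`. -/
def cyclicShift {n : ℕ} (x : Fin n) (p : ℤ) : Fin n :=
  ⟨((x + p : ℤ) % n).toNat, by
    have hn : (0 : ℤ) < n := by exact_mod_cast x.pos
    have h1 := Int.emod_lt_of_pos (x + p : ℤ) hn
    have h2 := Int.emod_nonneg (x + p : ℤ) hn.ne'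
    omega⟩

theorem cyclicShift_cases {n : ℕ} (x : Fin n) (p : ℤ) (hp : 2 * p.natAbs < n) :
    ((cyclicShift x p : ℕ) : ℤ) = x + p ∨
      ((cyclicShift x p : ℕ) : ℤ) = x + p + n ∨ ((cyclicShift x p : ℕ) : ℤ) = x + p - n := by
  have hx := x.isLt
  have hn : (0 : ℤ) < n := by exact_mod_cast x.pos
  have h1 := Int.emod_lt_of_pos (x + p : ℤ) hn
  have h2 := Int.emod_nonneg (x + p : ℤ) hn.ne'
  have hval : ((cyclicShift x p : ℕ) : ℤ) = (x + p : ℤ) % n := by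
    simp only [cyclicShift]
    omega
  rw [hval]
  have h3 := Int.emod_add_mul_ediv (x + p : ℤ) n
  have hlo : -(n : ℤ) < x + p := by omega
  have hhi : (x + p : ℤ) < 2 * n := by omega
  have hk1 : (x + p : ℤ) / n < 2 := by
    by_contra! h
    nlinarith
  have hk2 : -2 < (x + p : ℤ) / n := by
    by_contra! h
    nlinarith
  generalize (x + p : ℤ) / n = k at *
  obtain rfl | rfl | rfl : k = -1 ∨ k = 0 ∨ k = 1 := by omega
  all_goals omega

/-- Translation by `p` on the torus. -/
def torusShift {n : ℕ} (u : Vx n) (p : ℤ × ℤ) : Vx n :=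
  (cyclicShift u.1 p.1, cyclicShift u.2 p.2)

theorem tdist_torusShift {n : ℕ} (u : Vx n) (p : ℤ × ℤ)
    (hp : 2 * (p.1.natAbs + p.2.natAbs) < n) :
    tdist n u (torusShift u p) = p.1.natAbs + p.2.natAbs := by
  have h1 := cyclicShift_cases u.1 p.1 (by omega)
  have h2 := cyclicShift_cases u.2 p.2 (by omega)
  have hx := u.1.isLt
  have hy := u.2.isLt
  have hx' := (cyclicShift u.1 p.1).isLt
  have hy' := (cyclicShift u.2 p.2).isLt
  simp only [tdist, torusShift]
  congr 1 <;> omega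

theorem torusShift_inj {n : ℕ} (u : Vx n) {p q : ℤ × ℤ}
    (hp : 2 * (p.1.natAbs + p.2.natAbs) < n) (hq : 2 * (q.1.natAbs + q.2.natAbs) < n)
    (h : torusShift u p = torusShift u q) : p = q := by
  obtain ⟨h1, h2⟩ := Prod.mk.inj h
  have a1 := cyclicShift_cases u.1 p.1 (by omega)
  have a2 := cyclicShift_cases u.2 p.2 (by omega)
  have b1 := cyclicShift_cases u.1 q.1 (by omega)
  have b2 := cyclicShift_cases u.2 q.2 (by omega)
  rw [← h1] at b1
  rw [← h2] at b2
  ext <;> omega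

/-- An enumeration of the `4 * j` points of `ℤ²` of `ℓ¹`-norm `j`. -/
def spherePoint (j : ℕ) (t : ℕ × Fin 4) : ℤ × ℤ :=
  match t.2 with
  | 0 => (j - t.1, t.1)
  | 1 => (-t.1, j - t.1)
  | 2 => (t.1 - j, -t.1)
  | 3 => (t.1, t.1 - j)

theorem spherePoint_natAbs {j : ℕ} {t : ℕ × Fin 4} (ht : t.1 < j) :
    (spherePoint j t).1.natAbs + (spherePoint j t).2.natAbs = j := by
  obtain ⟨k, i⟩ := t
  fin_cases i <;> simp only [spherePoint] <;> omega

theorem spherePoint_inj {j : ℕ} {s t : ℕ × Fin 4} (hs : s.1 < j) (ht : t.1 < j)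
    (h : spherePoint j s = spherePoint j t) : s = t := by
  obtain ⟨k, i⟩ := s
  obtain ⟨l, i'⟩ := t
  fin_cases i <;> fin_cases i' <;> simp [spherePoint] at h hs ht ⊢ <;> omega

theorem le_card_sphere {n : ℕ} (u : Vx n) {j : ℕ} (hj : 2 * j < n) :
    4 * j ≤ #(univ.filter fun w => tdist n u w = j) := by
  have hc : #(range j ×ˢ (univ : Finset (Fin 4))) = 4 * j := by
    simp [mul_comm]
  rw [← hc]
  have hb : ∀ t ∈ range j ×ˢ (univ : Finset (Fin 4)), t.1 < j := fun t ht => by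
    simpa using ht
  refine card_le_card_of_injOn (fun t => torusShift u (spherePoint j t)) ?_ ?_
  · intro t ht
    have h := spherePoint_natAbs (hb t ht)
    simp only [coe_filter, mem_univ, true_and, Set.mem_ofPred_eq]
    rw [tdist_torusShift u _ (by omega), h]
  · intro s hs t ht hst
    have h1 := spherePoint_natAbs (hb s hs)
    have h2 := spherePoint_natAbs (hb t ht)
    exact spherePoint_inj (hb s hs) (hb t ht)
      (torusShift_inj u (by omega) (by omega) hst)

theorem four_mul_log_le {n : ℕ} (hn : 3 ≤ n) (u : Vx n) :
    4 * Real.log ((n : ℝ) / 2) ≤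
      ∑ w ∈ univ.filter (fun w => w ≠ u), ((tdist n u w : ℝ) ^ 2)⁻¹ := by
  set m := (n - 1) / 2 with hm
  have hmn : (n : ℝ) / 2 ≤ ((m + 1 : ℕ) : ℝ) := by
    have : n ≤ 2 * (m + 1) := by omega
    have : (n : ℝ) ≤ 2 * ((m + 1 : ℕ) : ℝ) := by exact_mod_cast this
    linarith
  have hn' : (0 : ℝ) < n := by exact_mod_cast (by omega : 0 < n)
  have hself : tdist n u u = 0 := by simp [tdist]
  calc 4 * Real.log ((n : ℝ) / 2) ≤ 4 * Real.log ((m + 1 : ℕ) : ℝ) := by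
        gcongr
    _ ≤ 4 * (harmonic m : ℝ) := by
        gcongr
        exact log_add_one_le_harmonic m
    _ = ∑ j ∈ Icc 1 m, (4 * j : ℝ) * ((j : ℝ) ^ 2)⁻¹ := by
        rw [harmonic_eq_sum_Icc]
        push_cast
        rw [mul_sum]
        refine sum_congr rfl fun j hj => ?_
        have : (j : ℝ) ≠ 0 := by
          have := (mem_Icc.1 hj).1
          positivity
        field_simp
    _ ≤ ∑ j ∈ Icc 1 m, ∑ w ∈ univ.filter (fun w => w ≠ u) with tdist n u w = j,
          ((tdist n u w : ℝ) ^ 2)⁻¹ := by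
        refine sum_le_sum fun j hj => ?_
        rw [mem_Icc] at hj
        have hfil : ((univ.filter fun w => w ≠ u).filter fun w => tdist n u w = j) =
            univ.filter fun w => tdist n u w = j := by
          ext w
          simp only [mem_filter, mem_univ, true_and, and_iff_right_iff_imp]
          rintro hw rfl
          omega
        rw [hfil, sum_congr rfl fun w hw => by rw [(mem_filter.1 hw).2], sum_const, nsmul_eq_mul]
        gcongr
        exact_mod_cast le_card_sphere u (j := j) (by omega)
    _ ≤ ∑ w ∈ univ.filter (fun w => w ≠ u), ((tdist n u w : ℝ) ^ 2)⁻¹ :=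
        sum_fiberwise_le_sum_of_sum_fiber_nonneg fun _ _ =>
          sum_nonneg fun _ _ => by positivity

theorem Zfac_le {n : ℕ} (hn : 3 ≤ n) (u : Vx n) :
    Zfac n u ≤ (4 * Real.log ((n : ℝ) / 2))⁻¹ := by
  have hL : 0 < Real.log ((n : ℝ) / 2) := by
    apply Real.log_pos
    have : (3 : ℝ) ≤ n := by exact_mod_cast hn
    linarith
  exact inv_anti₀ (by positivity) (four_mul_log_le hn u)

/-- The distance on the cycle `Fin n`, one of the two summands of `tdist`. -/
def cyclicDist {n : ℕ} (x y : Fin n) : ℕ :=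
  min ((x : ℤ) - (y : ℤ)).natAbs (n - ((x : ℤ) - (y : ℤ)).natAbs)

theorem cyclicShift_eq {n : ℕ} {x y : Fin n} {p k : ℤ} (h : (x + p : ℤ) = y + n * k) :
    cyclicShift x p = y := by
  have hy := y.isLt
  ext
  simp only [cyclicShift]
  rw [h, Int.add_mul_emod_self_left, Int.emod_eq_of_lt (by omega) (by omega), Int.toNat_natCast]

theorem cyclicShift_of_cyclicDist_zero {n : ℕ} {x y : Fin n} (h : cyclicDist x y = 0) :
    cyclicShift x 0 = y := by
  have hx := x.isLt
  have hy := y.isLt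
  unfold cyclicDist at h
  exact cyclicShift_eq (k := 0) (by omega)

theorem cyclicShift_of_cyclicDist_one {n : ℕ} {x y : Fin n} (h : cyclicDist x y = 1) :
    cyclicShift x 1 = y ∨ cyclicShift x (-1) = y := by
  have hx := x.isLt
  have hy := y.isLt
  unfold cyclicDist at h
  rcases (by omega : (y : ℤ) = x + 1 ∨ (y : ℤ) = x - 1 ∨ (y : ℤ) = x + 1 - n ∨
    (y : ℤ) = x - 1 + n) with h | h | h | h
  · exact Or.inl (cyclicShift_eq (k := 0) (by omega))
  · exact Or.inr (cyclicShift_eq (k := 0) (by omega))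
  · exact Or.inl (cyclicShift_eq (k := 1) (by omega))
  · exact Or.inr (cyclicShift_eq (k := -1) (by omega))

/-- The local neighbours of `u`. -/
noncomputable def localNbrs (n : ℕ) (u : Vx n) : Finset (Vx n) :=
  univ.filter fun v => tdist n u v = 1

theorem card_localNbrs_le (n : ℕ) (u : Vx n) : #(localNbrs n u) ≤ 4 := by
  let D : Finset (ℤ × ℤ) := {(1, 0), (-1, 0), (0, 1), (0, -1)}
  have hsub : localNbrs n u ⊆ D.image (torusShift u) := by
    intro v hv
    have hv : tdist n u v = 1 := (mem_filter.1 hv).2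
    have hsum : cyclicDist u.1 v.1 + cyclicDist u.2 v.2 = 1 := hv
    rw [mem_image]
    rcases (by omega : cyclicDist u.1 v.1 = 0 ∧ cyclicDist u.2 v.2 = 1 ∨
      cyclicDist u.1 v.1 = 1 ∧ cyclicDist u.2 v.2 = 0) with ⟨h1, h2⟩ | ⟨h1, h2⟩
    · rcases cyclicShift_of_cyclicDist_one h2 with h | h
      · exact ⟨(0, 1), by simp [D], Prod.ext (cyclicShift_of_cyclicDist_zero h1) h⟩
      · exact ⟨(0, -1), by simp [D], Prod.ext (cyclicShift_of_cyclicDist_zero h1) h⟩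
    · rcases cyclicShift_of_cyclicDist_one h1 with h | h
      · exact ⟨(1, 0), by simp [D], Prod.ext h (cyclicShift_of_cyclicDist_zero h2)⟩
      · exact ⟨(-1, 0), by simp [D], Prod.ext h (cyclicShift_of_cyclicDist_zero h2)⟩
  exact (card_le_card hsub).trans (card_image_le.trans (by decide))

/-- Pairs `(b, e)` at distance at least two, where `e` is a local neighbour of `u` and `b` is
reached from `u` by two local steps through a neighbour other than `e`. -/
noncomputable def farArcs (n : ℕ) (u : Vx n) : Finset (Vx n × Vx n) :=
  ((localNbrs n u).biUnion fun e => ((localNbrs n u).erase e).biUnion fun a =>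
    (localNbrs n a).image fun b => (b, e)).filter fun p => 2 ≤ tdist n p.1 p.2

theorem card_farArcs_le (n : ℕ) (u : Vx n) : #(farArcs n u) ≤ 48 := by
  refine (card_filter_le _ _).trans ?_
  have hN := card_localNbrs_le n u
  refine (card_biUnion_le_card_mul _ _ 12 fun e he => ?_).trans (by omega)
  have hE := card_erase_of_mem he
  refine (card_biUnion_le_card_mul _ _ 4 fun a _ => ?_).trans (by omega)
  exact card_image_le.trans (card_localNbrs_le n a)

theorem tdist_pos {n : ℕ} {u v : Vx n} (h : u ≠ v) : 0 < tdist n u v := by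
  by_contra h0
  apply h
  have h1 := u.1.isLt
  have h2 := u.2.isLt
  have h3 := v.1.isLt
  have h4 := v.2.isLt
  unfold tdist at h0
  ext <;> omega

theorem mem_farArcs {n : ℕ} {c : Vx n → Vx n} {u a b e : Vx n} (hae : a ≠ e)
    (hua : tdist n u a = 1) (hab : tdist n a b = 1) (hue : tdist n u e = 1)
    (hbe : edgeKind n c b e true) : (b, e) ∈ farArcs n u ∧ (c b = e ∨ c e = b) := by
  obtain ⟨⟨hne, hedge⟩, hkind⟩ := hbe
  have h1 : tdist n b e ≠ 1 := by simpa using hkind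
  have h0 := tdist_pos hne
  refine ⟨?_, hedge.resolve_left h1⟩
  refine mem_filter.2 ⟨?_, show 2 ≤ tdist n b e by omega⟩
  simp only [mem_biUnion, mem_image, localNbrs, mem_erase, mem_filter, mem_univ, true_and]
  exact ⟨e, hue, a, ⟨hae, hua⟩, b, hab, rfl⟩

theorem exists_farArc {n : ℕ} {c : Vx n → Vx n} {u : Vx n}
    (h : cyclePat n c u false false true false ∨ cyclePat n c u false true false false) :
    ∃ b e, (b, e) ∈ farArcs n u ∧ (c b = e ∨ c e = b) := by
  rcases h with ⟨a, b, e, -, hae, -, -, -, -, hua, hab, hbe, heu⟩ |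
    ⟨a, b, e, -, hae, -, -, -, -, hua, hab, hbe, heu⟩
  · exact ⟨b, e, mem_farArcs hae (hua.2.2 rfl) (hab.2.2 rfl)
      (by rw [tdist_comm]; exact heu.2.2 rfl) hbe⟩
  · refine ⟨b, a, mem_farArcs (c := c) hae.symm (by rw [tdist_comm]; exact heu.2.2 rfl)
      (by rw [tdist_comm]; exact hbe.2.2 rfl) (hua.2.2 rfl) ?_⟩
    obtain ⟨⟨h1, h2⟩, h3⟩ := hab
    rw [tdist_comm] at h2 h3
    exact ⟨⟨h1.symm, by tauto⟩, h3⟩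

/-- Probability bound for the event `E2ᵤ`. -/
theorem prob_E2 :
    ∀ n : ℕ, 3 ≤ n → ∀ u : Vx n,
      Pr n {c | cyclePat n c u false false true false ∨ cyclePat n c u false true false false} <
        (64 / 9) * (Real.log ((n : ℝ) / 2))⁻¹ := by
  intro n hn u
  have hL : 0 < Real.log ((n : ℝ) / 2) := by
    apply Real.log_pos
    have : (3 : ℝ) ≤ n := by exact_mod_cast hn
    linarith
  set A := farArcs n u ∪ (farArcs n u).image Prod.swap with hA
  have hcard : #A ≤ 96 := by
    have h1 := card_union_le (farArcs n u) ((farArcs n u).image Prod.swap)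
    have h2 := card_image_le (s := farArcs n u) (f := Prod.swap)
    have h3 := card_farArcs_le n u
    rw [hA]
    omega
  have hfar : ∀ p ∈ A, 2 ≤ tdist n p.1 p.2 := by
    intro p hp
    rcases mem_union.1 hp with hp | hp
    · exact (mem_filter.1 hp).2
    · obtain ⟨q, hq, rfl⟩ := mem_image.1 hp
      simpa [tdist_comm n q.2 q.1] using (mem_filter.1 hq).2
  have hterm : ∀ p ∈ A, Pr n {c | c p.1 = p.2} ≤ (16 * Real.log ((n : ℝ) / 2))⁻¹ := by
    intro p hp
    have hd : (2 : ℝ) ≤ tdist n p.1 p.2 := by exact_mod_cast hfar p hp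
    have hd' : ((tdist n p.1 p.2 : ℝ) ^ 2)⁻¹ ≤ (4 : ℝ)⁻¹ := by
      gcongr
      nlinarith
    calc Pr n {c | c p.1 = p.2} ≤ Zfac n p.1 * ((tdist n p.1 p.2 : ℝ) ^ 2)⁻¹ :=
          Pr_choice_le n p.1 p.2
      _ ≤ (4 * Real.log ((n : ℝ) / 2))⁻¹ * (4 : ℝ)⁻¹ :=
          mul_le_mul (Zfac_le hn p.1) hd' (by positivity) (by positivity)
      _ = (16 * Real.log ((n : ℝ) / 2))⁻¹ := by
          rw [← mul_inv]
          ring_nf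
  calc Pr n {c | cyclePat n c u false false true false ∨ cyclePat n c u false true false false}
      ≤ ∑ p ∈ A, Pr n {c | c p.1 = p.2} := by
        refine Pr_le_sum n _ _ fun c hc => ?_
        obtain ⟨b, e, hbe, h⟩ := exists_farArc hc
        rcases h with h | h
        · exact ⟨(b, e), mem_union_left _ hbe, h⟩
        · exact ⟨(e, b), mem_union_right _ (mem_image.2 ⟨_, hbe, rfl⟩), h⟩
    _ ≤ #A • (16 * Real.log ((n : ℝ) / 2))⁻¹ := sum_le_card_nsmul _ _ _ hterm
    _ ≤ 96 * (16 * Real.log ((n : ℝ) / 2))⁻¹ := by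
        rw [nsmul_eq_mul]
        gcongr
        exact_mod_cast hcard
    _ < (64 / 9) * (Real.log ((n : ℝ) / 2))⁻¹ := by
        rw [mul_inv, ← mul_assoc]
        gcongr
        norm_num
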